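/- Let k ∈ ℕ and let f : ℝ^d × ℝ^d → ℂ be measurable with ‖f‖_{X_{k+1}} < ∞. Then for every η ∈ ℝ the function R_{iη}f given by (R_{iη}f)(x,v) := ∫₀^{t₋(x,v)} e^{−iηt} f(x − t·v, v) dt satisfies ‖R_{iη}f‖_{X_k} ≤ D‖f‖_{X_{k+1}}, and the boundary values are attained uniformly in η: lim_{ε→0⁺} sup_{η∈ℝ} ‖R_{ε+iη}f − R_{iη}f‖_{X_k} = 0, where (R_{ε+iη}f)(x,v) := ∫₀^{t₋(x,v)} e^{−(ε+iη)t} f(x − t·v, v) dt. -/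

import Mathlib

open MeasureTheory Set Filter
open scoped ENNReal NNReal Topology

/-- The backward exit time `t₋(x,v) = inf {s > 0 : x - s • v ∉ Ω}` (with `inf ∅ = ∞`),
valued in `ℝ≥0∞`. -/
noncomputable def tminus {d : ℕ} (Ω : Set (EuclideanSpace ℝ (Fin d)))
    (x v : EuclideanSpace ℝ (Fin d)) : ℝ≥0∞ :=
  ⨅ (s : ℝ) (_ : 0 < s ∧ x - s • v ∉ Ω), ENNReal.ofReal s

/-- The norm `‖f‖_{X_s} = ∫_{Ω×ℝ^d} max(1,|v|^{-s}) |f(x,v)| dx m(dv)`. -/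
noncomputable def Xnorm {d : ℕ} (Ω : Set (EuclideanSpace ℝ (Fin d)))
    (m : Measure (EuclideanSpace ℝ (Fin d))) (s : ℕ)
    (f : EuclideanSpace ℝ (Fin d) → EuclideanSpace ℝ (Fin d) → ℂ) : ℝ≥0∞ :=
  ∫⁻ x in Ω, ∫⁻ v, ENNReal.ofReal (max 1 (‖v‖⁻¹ ^ s)) * (‖f x v‖₊ : ℝ≥0∞) ∂m

/-- The resolvent of the free transport operator with absorbing boundary conditions:
`(R_{ε+iη} f)(x,v) = ∫₀^{t₋(x,v)} e^{-(ε+iη)t} f(x - t v, v) dt`. -/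
noncomputable def resT0 {d : ℕ} (Ω : Set (EuclideanSpace ℝ (Fin d))) (ε η : ℝ)
    (f : EuclideanSpace ℝ (Fin d) → EuclideanSpace ℝ (Fin d) → ℂ)
    (x v : EuclideanSpace ℝ (Fin d)) : ℂ :=
  ∫ t in {t : ℝ | 0 < t ∧ ENNReal.ofReal t < tminus Ω x v},
    Complex.exp (-((ε : ℂ) + (η : ℂ) * Complex.I) * (t : ℂ)) * f (x - t • v) v

section FreeTransport

variable {d : ℕ}

/-- The X-ray type transform `(x,v) ↦ ∫₀^{D/|v|} H(x - t v, v) dt` of a nonnegative function. -/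
noncomputable def transportTrace (D : ℝ)
    (H : EuclideanSpace ℝ (Fin d) × EuclideanSpace ℝ (Fin d) → ℝ≥0∞)
    (x v : EuclideanSpace ℝ (Fin d)) : ℝ≥0∞ :=
  ∫⁻ t in Ioc 0 (D / ‖v‖), H (x - t • v, v)

lemma measurable_transportTrace (D : ℝ)
    {H : EuclideanSpace ℝ (Fin d) × EuclideanSpace ℝ (Fin d) → ℝ≥0∞} (hH : Measurable H) :
    Measurable (Function.uncurry (transportTrace D H)) := by
  have hset : MeasurableSet {q : (EuclideanSpace ℝ (Fin d) × EuclideanSpace ℝ (Fin d)) × ℝ |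
      0 < q.2 ∧ q.2 ≤ D / ‖q.1.2‖} :=
    (measurableSet_lt measurable_const measurable_snd).inter
      (measurableSet_le measurable_snd (measurable_const.div measurable_fst.snd.norm))
  have hmeas : Measurable fun q : (EuclideanSpace ℝ (Fin d) × EuclideanSpace ℝ (Fin d)) × ℝ =>
      H (q.1.1 - q.2 • q.1.2, q.1.2) := hH.comp (by fun_prop)
  convert (hmeas.indicator hset).lintegral_prod_right' (ν := volume) using 2 with p
  rw [Function.uncurry, transportTrace, ← lintegral_indicator measurableSet_Ioc]
  rfl

lemma lintegral_transportTrace (D : ℝ)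
    {H : EuclideanSpace ℝ (Fin d) × EuclideanSpace ℝ (Fin d) → ℝ≥0∞} (hH : Measurable H)
    (v : EuclideanSpace ℝ (Fin d)) :
    ∫⁻ x, transportTrace D H x v = ENNReal.ofReal (D / ‖v‖) * ∫⁻ x, H (x, v) := by
  have hmeas : Measurable fun q : EuclideanSpace ℝ (Fin d) × ℝ => H (q.1 - q.2 • v, v) :=
    hH.comp (by fun_prop)
  unfold transportTrace
  rw [lintegral_lintegral_swap hmeas.aemeasurable]
  calc
    _ = ∫⁻ _ in Ioc 0 (D / ‖v‖), ∫⁻ x, H (x, v) :=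
        lintegral_congr fun t => lintegral_sub_right_eq_self (fun x => H (x, v)) (t • v)
    _ = _ := by simp [mul_comm]

lemma max_one_pow_mul_le (r : ℝ) (hr : 0 ≤ r) (k : ℕ) :
    max 1 (r ^ k) * r ≤ max 1 (r ^ (k + 1)) := by
  rcases le_total r 1 with h | h
  · rw [max_eq_left (pow_le_one₀ hr h)]
    exact (by simpa using h : 1 * r ≤ 1).trans (le_max_left _ _)
  · rw [max_eq_right (one_le_pow₀ h), pow_succ]
    exact le_max_right _ _

/-- Integrating the weighted X-ray type transform costs a factor `D` and one power of `|v|⁻¹`. -/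
lemma lintegral_weight_transportTrace_le {D : ℝ} (hD : 0 ≤ D)
    (Ω : Set (EuclideanSpace ℝ (Fin d)))
    (m : Measure (EuclideanSpace ℝ (Fin d))) [SigmaFinite m] (k : ℕ)
    {H : EuclideanSpace ℝ (Fin d) × EuclideanSpace ℝ (Fin d) → ℝ≥0∞} (hH : Measurable H)
    {φ : EuclideanSpace ℝ (Fin d) → ℝ≥0∞} (hφ : Measurable φ) :
    ∫⁻ x in Ω, ∫⁻ v, ENNReal.ofReal (max 1 (‖v‖⁻¹ ^ k)) * (φ v * transportTrace D H x v) ∂m ≤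
      ENNReal.ofReal D *
        ∫⁻ v, φ v * (ENNReal.ofReal (max 1 (‖v‖⁻¹ ^ (k + 1))) * ∫⁻ x, H (x, v)) ∂m := by
  have htrace := measurable_transportTrace D hH
  have hw : Measurable fun v : EuclideanSpace ℝ (Fin d) =>
      ENNReal.ofReal (max 1 (‖v‖⁻¹ ^ k)) := by fun_prop
  have hjoint : Measurable fun p : EuclideanSpace ℝ (Fin d) × EuclideanSpace ℝ (Fin d) =>
      ENNReal.ofReal (max 1 (‖p.2‖⁻¹ ^ k)) * (φ p.2 * transportTrace D H p.1 p.2) :=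
    (hw.comp measurable_snd).mul ((hφ.comp measurable_snd).mul htrace)
  have hvel (v : EuclideanSpace ℝ (Fin d)) :
      ∫⁻ x, ENNReal.ofReal (max 1 (‖v‖⁻¹ ^ k)) * (φ v * transportTrace D H x v) ≤
        ENNReal.ofReal D *
          (φ v * (ENNReal.ofReal (max 1 (‖v‖⁻¹ ^ (k + 1))) * ∫⁻ x, H (x, v))) := by
    have hsec : Measurable fun x => transportTrace D H x v :=
      htrace.of_uncurry_right
    have hweight : ENNReal.ofReal (max 1 (‖v‖⁻¹ ^ k)) * ENNReal.ofReal ‖v‖⁻¹ ≤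
        ENNReal.ofReal (max 1 (‖v‖⁻¹ ^ (k + 1))) := by
      rw [← ENNReal.ofReal_mul (zero_le_one.trans (le_max_left _ _))]
      exact ENNReal.ofReal_le_ofReal
        (max_one_pow_mul_le ‖v‖⁻¹ (inv_nonneg.2 (norm_nonneg v)) k)
    rw [lintegral_const_mul _ (hsec.const_mul _), lintegral_const_mul _ hsec,
      lintegral_transportTrace D hH, div_eq_mul_inv, ENNReal.ofReal_mul hD]
    calc
      _ = ENNReal.ofReal D * (φ v * (ENNReal.ofReal (max 1 (‖v‖⁻¹ ^ k)) *
            ENNReal.ofReal ‖v‖⁻¹ * ∫⁻ x, H (x, v))) := by ac_rfl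
      _ ≤ _ := by gcongr
  have hswap : ∫⁻ x, ∫⁻ v, ENNReal.ofReal (max 1 (‖v‖⁻¹ ^ k)) *
        (φ v * transportTrace D H x v) ∂m =
      ∫⁻ v, (∫⁻ x, ENNReal.ofReal (max 1 (‖v‖⁻¹ ^ k)) *
        (φ v * transportTrace D H x v)) ∂m :=
    lintegral_lintegral_swap hjoint.aemeasurable
  refine (setLIntegral_le_lintegral _ _).trans (hswap.trans_le ?_)
  rw [← lintegral_const_mul' _ _ ENNReal.ofReal_ne_top]
  exact lintegral_mono hvel

variable {Ω : Set (EuclideanSpace ℝ (Fin d))} {x v : EuclideanSpace ℝ (Fin d)}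

lemma measurableSet_lt_tminus (Ω : Set (EuclideanSpace ℝ (Fin d)))
    (x v : EuclideanSpace ℝ (Fin d)) :
    MeasurableSet {t : ℝ | 0 < t ∧ ENNReal.ofReal t < tminus Ω x v} :=
  (measurableSet_lt measurable_const measurable_id).inter
    (measurableSet_lt ENNReal.measurable_ofReal measurable_const)

lemma sub_smul_mem_of_lt_tminus {t : ℝ} (ht : 0 < t)
    (h : ENNReal.ofReal t < tminus Ω x v) : x - t • v ∈ Ω := by
  by_contra hmem
  exact h.not_ge (iInf₂_le t ⟨ht, hmem⟩)

lemma le_diam_div_norm_of_lt_tminus (hΩ : Bornology.IsBounded Ω) (hx : x ∈ Ω) (hv : v ≠ 0)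
    {t : ℝ} (ht : 0 < t) (h : ENNReal.ofReal t < tminus Ω x v) :
    t ≤ Metric.diam Ω / ‖v‖ := by
  rw [le_div_iff₀ (norm_pos_iff.2 hv)]
  simpa [dist_eq_norm, norm_smul, abs_of_pos ht] using
    Metric.dist_le_diam_of_mem hΩ hx (sub_smul_mem_of_lt_tminus ht h)

lemma norm_exp_resolvent (ε η t : ℝ) :
    ‖Complex.exp (-((ε : ℂ) + (η : ℂ) * Complex.I) * (t : ℂ))‖ = Real.exp (-(ε * t)) := by
  simp [Complex.norm_exp]

variable {f : EuclideanSpace ℝ (Fin d) → EuclideanSpace ℝ (Fin d) → ℂ}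

/-- The integral of `|f|` along the backward characteristic is controlled by the X-ray type
transform of `|f|` extended by zero. -/
lemma setLIntegral_lt_tminus_le (hΩ : Bornology.IsBounded Ω) (hx : x ∈ Ω) (hv : v ≠ 0) :
    ∫⁻ t in {t : ℝ | 0 < t ∧ ENNReal.ofReal t < tminus Ω x v}, ‖f (x - t • v) v‖ₑ ≤
      transportTrace (Metric.diam Ω)
        ((Ω ×ˢ univ).indicator fun p => ‖Function.uncurry f p‖ₑ) x v := by
  have hsub : {t : ℝ | 0 < t ∧ ENNReal.ofReal t < tminus Ω x v} ⊆
      Ioc 0 (Metric.diam Ω / ‖v‖) := fun t ht =>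
    ⟨ht.1, le_diam_div_norm_of_lt_tminus hΩ hx hv ht.1 ht.2⟩
  calc
    _ = ∫⁻ t in {t : ℝ | 0 < t ∧ ENNReal.ofReal t < tminus Ω x v},
          (Ω ×ˢ univ).indicator (fun p => ‖Function.uncurry f p‖ₑ) (x - t • v, v) := by
        refine setLIntegral_congr_fun (measurableSet_lt_tminus Ω x v) fun t ht => ?_
        simp [indicator, sub_smul_mem_of_lt_tminus ht.1 ht.2]
    _ ≤ _ := lintegral_mono_set hsub

lemma enorm_resT0_zero_le (hΩ : Bornology.IsBounded Ω) (hx : x ∈ Ω) (hv : v ≠ 0) (η : ℝ) :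
    ‖resT0 Ω 0 η f x v‖ₑ ≤ transportTrace (Metric.diam Ω)
      ((Ω ×ˢ univ).indicator fun p => ‖Function.uncurry f p‖ₑ) x v := by
  refine (enorm_integral_le_lintegral_enorm _).trans
    (le_trans (lintegral_mono fun t => ?_) (setLIntegral_lt_tminus_le hΩ hx hv))
  rw [enorm_mul, ← ofReal_norm, norm_exp_resolvent]
  simp

lemma norm_exp_resolvent_sub {ε t : ℝ} (hε : 0 ≤ ε) (ht : 0 ≤ t) (η : ℝ) :
    ‖Complex.exp (-((ε : ℂ) + (η : ℂ) * Complex.I) * (t : ℂ)) -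
      Complex.exp (-(((0 : ℝ) : ℂ) + (η : ℂ) * Complex.I) * (t : ℂ))‖ =
      1 - Real.exp (-(ε * t)) := by
  have h : Complex.exp (-((ε : ℂ) + (η : ℂ) * Complex.I) * (t : ℂ)) =
      Complex.exp (-(((0 : ℝ) : ℂ) + (η : ℂ) * Complex.I) * (t : ℂ)) *
        ((Real.exp (-(ε * t)) : ℝ) : ℂ) := by
    rw [Complex.ofReal_exp, ← Complex.exp_add]
    congr 1
    push_cast
    ring
  have hle : Real.exp (-(ε * t)) ≤ 1 := Real.exp_le_one_iff.2 (by nlinarith [mul_nonneg hε ht])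
  rw [h, ← mul_sub_one, norm_mul, norm_exp_resolvent, ← Complex.ofReal_one,
    ← Complex.ofReal_sub, Complex.norm_real, Real.norm_eq_abs, abs_sub_comm,
    abs_of_nonneg (sub_nonneg.2 hle)]
  simp

lemma integrableOn_resolvent_iff (hf : Measurable (Function.uncurry f))
    (hΩ : Bornology.IsBounded Ω) (hx : x ∈ Ω) (hv : v ≠ 0) {ε : ℝ} (hε : 0 ≤ ε) (η : ℝ) :
    IntegrableOn (fun t : ℝ => Complex.exp (-((ε : ℂ) + (η : ℂ) * Complex.I) * (t : ℂ)) *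
        f (x - t • v) v) {t : ℝ | 0 < t ∧ ENNReal.ofReal t < tminus Ω x v} ↔
      IntegrableOn (fun t : ℝ => f (x - t • v) v)
        {t : ℝ | 0 < t ∧ ENNReal.ofReal t < tminus Ω x v} := by
  have hfm : Measurable fun t : ℝ => f (x - t • v) v :=
    hf.comp (by fun_prop : Measurable fun t : ℝ => (x - t • v, v))
  have hem : Measurable fun t : ℝ =>
      Complex.exp (-((ε : ℂ) + (η : ℂ) * Complex.I) * (t : ℂ)) := by fun_prop
  constructor <;> intro h
  · refine (h.norm.const_mul (Real.exp (ε * (Metric.diam Ω / ‖v‖)))).mono'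
      hfm.aestronglyMeasurable
      (ae_restrict_of_forall_mem (measurableSet_lt_tminus Ω x v) fun t ht => ?_)
    rw [norm_mul, norm_exp_resolvent, ← mul_assoc, ← Real.exp_add]
    refine le_mul_of_one_le_left (norm_nonneg _) (Real.one_le_exp ?_)
    nlinarith [mul_le_mul_of_nonneg_left
      (le_diam_div_norm_of_lt_tminus hΩ hx hv ht.1 ht.2) hε]
  · refine h.norm.mono' (hem.mul hfm).aestronglyMeasurable
      (ae_restrict_of_forall_mem (measurableSet_lt_tminus Ω x v) fun t ht => ?_)
    rw [norm_mul, norm_exp_resolvent]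
    exact mul_le_of_le_one_left (norm_nonneg _)
      (Real.exp_le_one_iff.2 (by nlinarith [mul_nonneg hε ht.1.le]))

lemma enorm_resT0_sub_le (hf : Measurable (Function.uncurry f))
    (hΩ : Bornology.IsBounded Ω) (hx : x ∈ Ω) (hv : v ≠ 0) {ε : ℝ} (hε : 0 ≤ ε) (η : ℝ) :
    ‖resT0 Ω ε η f x v - resT0 Ω 0 η f x v‖ₑ ≤
      ENNReal.ofReal (1 - Real.exp (-(ε * (Metric.diam Ω / ‖v‖)))) *
        transportTrace (Metric.diam Ω)
          ((Ω ×ˢ univ).indicator fun p => ‖Function.uncurry f p‖ₑ) x v := by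
  by_cases hint : IntegrableOn (fun t : ℝ => f (x - t • v) v)
      {t : ℝ | 0 < t ∧ ENNReal.ofReal t < tminus Ω x v}
  · unfold resT0
    rw [← integral_sub ((integrableOn_resolvent_iff hf hΩ hx hv hε η).2 hint)
      ((integrableOn_resolvent_iff hf hΩ hx hv le_rfl η).2 hint)]
    refine (enorm_integral_le_lintegral_enorm _).trans ?_
    refine le_trans ?_ (mul_le_mul_right (setLIntegral_lt_tminus_le hΩ hx hv) _)
    rw [← lintegral_const_mul' _ _ ENNReal.ofReal_ne_top]
    refine setLIntegral_mono' (measurableSet_lt_tminus Ω x v) fun t ht => ?_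
    rw [← sub_mul, enorm_mul, ← ofReal_norm, norm_exp_resolvent_sub hε ht.1.le]
    gcongr
    exact le_diam_div_norm_of_lt_tminus hΩ hx hv ht.1 ht.2
  · have hzero {δ : ℝ} (hδ : 0 ≤ δ) : resT0 Ω δ η f x v = 0 :=
      integral_undef ((integrableOn_resolvent_iff hf hΩ hx hv hδ η).not.2 hint)
    simp [hzero hε, hzero le_rfl]

/-- A pointwise bound by `φ(v)` times the X-ray type transform of `|f|` yields an `X_k` bound. -/
lemma Xnorm_le_of_forall_enorm_le (hΩopen : IsOpen Ω)
    {m : Measure (EuclideanSpace ℝ (Fin d))} [SigmaFinite m] (hm0 : m {0} = 0) (k : ℕ)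
    (hf : Measurable (Function.uncurry f))
    {φ : EuclideanSpace ℝ (Fin d) → ℝ≥0∞} (hφ : Measurable φ)
    {g : EuclideanSpace ℝ (Fin d) → EuclideanSpace ℝ (Fin d) → ℂ}
    (hg : ∀ x ∈ Ω, ∀ v, v ≠ 0 → ‖g x v‖ₑ ≤ φ v * transportTrace (Metric.diam Ω)
      ((Ω ×ˢ univ).indicator fun p => ‖Function.uncurry f p‖ₑ) x v) :
    Xnorm Ω m k g ≤ ENNReal.ofReal (Metric.diam Ω) *
      ∫⁻ v, φ v * (ENNReal.ofReal (max 1 (‖v‖⁻¹ ^ (k + 1))) * ∫⁻ x in Ω, ‖f x v‖ₑ) ∂m := by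
  have hH : Measurable ((Ω ×ˢ univ).indicator fun p => ‖Function.uncurry f p‖ₑ) :=
    hf.enorm.indicator (hΩopen.measurableSet.prod .univ)
  have hslice (v : EuclideanSpace ℝ (Fin d)) :
      ∫⁻ x in Ω, ‖f x v‖ₑ =
        ∫⁻ x, (Ω ×ˢ univ).indicator (fun p => ‖Function.uncurry f p‖ₑ) (x, v) := by
    rw [← lintegral_indicator hΩopen.measurableSet]
    refine lintegral_congr fun x => ?_
    by_cases hx : x ∈ Ω <;> simp [hx]
  simp_rw [hslice]
  refine le_trans ?_ (lintegral_weight_transportTrace_le Metric.diam_nonneg Ω m k hH hφ)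
  refine setLIntegral_mono' hΩopen.measurableSet fun x hx => lintegral_mono_ae ?_
  have hne : ∀ᵐ v ∂m, v ≠ 0 := by simpa [ae_iff] using hm0
  filter_upwards [hne] with v hv
  exact mul_le_mul_right (hg x hx v hv) _

lemma Xnorm_eq_lintegral_swap (Ω : Set (EuclideanSpace ℝ (Fin d)))
    (m : Measure (EuclideanSpace ℝ (Fin d))) [SigmaFinite m] (s : ℕ)
    (hf : Measurable (Function.uncurry f)) :
    Xnorm Ω m s f =
      ∫⁻ v, ENNReal.ofReal (max 1 (‖v‖⁻¹ ^ s)) * (∫⁻ x in Ω, ‖f x v‖ₑ) ∂m := by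
  have hjoint : Measurable fun p : EuclideanSpace ℝ (Fin d) × EuclideanSpace ℝ (Fin d) =>
      ENNReal.ofReal (max 1 (‖p.2‖⁻¹ ^ s)) * ‖f p.1 p.2‖ₑ :=
    .mul (by fun_prop) hf.enorm
  refine (lintegral_lintegral_swap hjoint.aemeasurable).trans (lintegral_congr fun v => ?_)
  exact lintegral_const_mul' _ _ ENNReal.ofReal_ne_top

lemma tendsto_lintegral_one_sub_exp_mul {α : Type*} [MeasurableSpace α] {μ : Measure α}
    {τ : α → ℝ} (hτ : Measurable τ) {F : α → ℝ≥0∞} (hF : Measurable F)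
    (hFint : ∫⁻ a, F a ∂μ ≠ ⊤) :
    Tendsto (fun ε : ℝ => ∫⁻ a, ENNReal.ofReal (1 - Real.exp (-(ε * τ a))) * F a ∂μ)
      (𝓝[>] 0) (𝓝 0) := by
  have hlim : Tendsto
      (fun ε : ℝ => ∫⁻ a, ENNReal.ofReal (1 - Real.exp (-(ε * τ a))) * F a ∂μ)
      (𝓝[>] 0) (𝓝 (∫⁻ _, 0 ∂μ)) := by
    refine tendsto_lintegral_filter_of_dominated_convergence F
      (.of_forall fun ε => .mul (by fun_prop) hF) (.of_forall fun ε => .of_forall fun a => ?_)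
      hFint ?_
    · refine mul_le_of_le_one_left' (ENNReal.ofReal_le_one.2 ?_)
      linarith [Real.exp_pos (-(ε * τ a))]
    · filter_upwards [ae_lt_top hF hFint] with a ha
      have hcont : Tendsto (fun ε : ℝ => ENNReal.ofReal (1 - Real.exp (-(ε * τ a))))
          (𝓝[>] 0) (𝓝 0) := by
        have : Continuous fun ε : ℝ => ENNReal.ofReal (1 - Real.exp (-(ε * τ a))) :=
          ENNReal.continuous_ofReal.comp (by fun_prop)
        simpa using (this.tendsto 0).mono_left nhdsWithin_le_nhds
      simpa using ENNReal.Tendsto.mul_const hcont (Or.inr ha.ne)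
  simpa using hlim

end FreeTransport

/-- For `f ∈ X_{k+1}`: the boundary resolvent satisfies `‖R_{iη}f‖_{X_k} ≤ D ‖f‖_{X_{k+1}}`
for every `η`, and `R_{ε+iη}f → R_{iη}f` in `X_k` as `ε → 0⁺`, uniformly in `η ∈ ℝ`. -/
theorem resT0_boundary_value {d : ℕ} (hd : 1 ≤ d)
    (Ω : Set (EuclideanSpace ℝ (Fin d))) (hΩopen : IsOpen Ω)
    (hΩne : Ω.Nonempty) (hΩbdd : Bornology.IsBounded Ω)
    (m : Measure (EuclideanSpace ℝ (Fin d))) [SigmaFinite m] (hm0 : m {0} = 0)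
    (k : ℕ)
    (f : EuclideanSpace ℝ (Fin d) → EuclideanSpace ℝ (Fin d) → ℂ)
    (hf : Measurable (Function.uncurry f))
    (hfX : Xnorm Ω m (k + 1) f < ⊤) :
    (∀ η : ℝ, Xnorm Ω m k (resT0 Ω 0 η f)
        ≤ ENNReal.ofReal (Metric.diam Ω) * Xnorm Ω m (k + 1) f) ∧
    Filter.Tendsto
      (fun ε : ℝ => ⨆ η : ℝ, Xnorm Ω m k (fun x v => resT0 Ω ε η f x v - resT0 Ω 0 η f x v))
      (nhdsWithin 0 (Set.Ioi 0)) (nhds 0) := by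
  constructor
  · intro η
    rw [Xnorm_eq_lintegral_swap Ω m (k + 1) hf]
    refine (Xnorm_le_of_forall_enorm_le hΩopen hm0 k hf (φ := fun _ => 1) measurable_const
      fun x hx v hv => ?_).trans_eq (by simp only [one_mul])
    simpa using enorm_resT0_zero_le hΩbdd hx hv η
  · rw [Xnorm_eq_lintegral_swap Ω m (k + 1) hf] at hfX
    have hF : Measurable fun v : EuclideanSpace ℝ (Fin d) =>
        ENNReal.ofReal (max 1 (‖v‖⁻¹ ^ (k + 1))) * ∫⁻ x in Ω, ‖f x v‖ₑ :=
      .mul (by fun_prop) hf.enorm.lintegral_prod_left'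
    have hlim := ENNReal.Tendsto.const_mul (a := ENNReal.ofReal (Metric.diam Ω))
      (tendsto_lintegral_one_sub_exp_mul (μ := m)
        (τ := fun v : EuclideanSpace ℝ (Fin d) => Metric.diam Ω / ‖v‖) (by fun_prop)
        hF hfX.ne) (Or.inr ENNReal.ofReal_ne_top)
    rw [mul_zero] at hlim
    refine tendsto_of_tendsto_of_tendsto_of_le_of_le' tendsto_const_nhds hlim
      (.of_forall fun _ => zero_le) ?_
    filter_upwards [self_mem_nhdsWithin] with ε hε
    exact iSup_le fun η => Xnorm_le_of_forall_enorm_le hΩopen hm0 k hf (by fun_prop)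
      fun x hx v hv => enorm_resT0_sub_le hf hΩbdd hx hv (le_of_lt hε) η
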